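/- There exist d ∈ ℕ and a ReLU MLP F : ℚ^d → ℚ^d such that for every L ∈ ℕ and every binary string x = b₁…b_L of length L, the sequence of iterates of F starting from the initial vector (1, 0, L, rbe(x), 0, …, 0) ∈ ℚ^d is eventually constant, and its eventual value has first coordinate equal to 0 and fifth coordinate equal to rqe(x). -/

import Mathlib

def relu (x : ℚ) : ℚ := max x 0

/-- `IsMLP f` says `f` is computed by a ReLU MLP with rational weights. -/
inductive IsMLP : {din dout : ℕ} → ((Fin din → ℚ) → (Fin dout → ℚ)) → Prop
  | base {din dout : ℕ} (W : Matrix (Fin dout) (Fin din) ℚ) (b : Fin dout → ℚ) :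
      IsMLP (fun x i => relu ((∑ j, W i j * x j) + b i))
  | step {din dmid dout : ℕ} {g : (Fin din → ℚ) → (Fin dmid → ℚ)} (hg : IsMLP g)
      (W : Matrix (Fin dout) (Fin dmid) ℚ) (b : Fin dout → ℚ) :
      IsMLP (fun x i => relu ((∑ j, W i j * g x j) + b i))

/-- A ReLU MLP, packaged with the function it computes. -/
structure MLP (din dout : ℕ) where
  eval : (Fin din → ℚ) → (Fin dout → ℚ)
  isMLP : IsMLP eval

/-- Rational binary encoding of a binary string. -/
def rbe : List Bool → ℚ
  | [] => 0
  | b :: t => ((if b then 1 else 0) + rbe t) / 2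

/-- Rational quaternary encoding of a binary string. -/
def rqe : List Bool → ℚ
  | [] => 0
  | b :: t => ((if b then (3 : ℚ) else 1) + rqe t) / 4

/-- The vector in `ℚ^d` whose first coordinates are the listed values, padded with zeros. -/
def initVec (d : ℕ) (vals : List ℚ) : Fin d → ℚ := fun i => vals.getD (i : ℕ) 0

/-- Closure of coordinates and constants under addition, scaling and relu. -/
inductive PL {d : ℕ} : ((Fin d → ℚ) → ℚ) → Prop
  | coord (i : Fin d) : PL (fun x => x i)
  | const (c : ℚ) : PL (fun _ => c)
  | add {f g : (Fin d → ℚ) → ℚ} : PL f → PL g → PL (fun x => f x + g x)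
  | smul (c : ℚ) {f : (Fin d → ℚ) → ℚ} : PL f → PL (fun x => c * f x)
  | relu {f : (Fin d → ℚ) → ℚ} : PL f → PL (fun x => relu (f x))

theorem PL.sub {d : ℕ} {f g : (Fin d → ℚ) → ℚ} (hf : PL f) (hg : PL g) :
    PL (fun x => f x - g x) := by
  have h := PL.add hf (PL.smul (-1) hg)
  have e : (fun x => f x - g x) = (fun x => f x + (-1) * g x) := by
    funext x; ring
  rw [e]; exact h

/-- `f` is an affine function of the output of `g`. -/
def AffOver {d m : ℕ} (g : (Fin d → ℚ) → (Fin m → ℚ)) (f : (Fin d → ℚ) → ℚ) : Prop :=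
  ∃ (w : Fin m → ℚ) (b : ℚ), ∀ x, f x = (∑ j, w j * g x j) + b

theorem IsMLP.nonneg {d m : ℕ} {g : (Fin d → ℚ) → (Fin m → ℚ)} (hg : IsMLP g)
    (x : Fin d → ℚ) (i : Fin m) : 0 ≤ g x i := by
  cases hg <;> exact le_max_right _ _

theorem AffOver.coord {d m : ℕ} (g : (Fin d → ℚ) → (Fin m → ℚ)) (i : Fin m) :
    AffOver g (fun x => g x i) :=
  ⟨fun j => if j = i then 1 else 0, 0, fun x => by simp⟩

theorem IsMLP.layer {d m k : ℕ} {g : (Fin d → ℚ) → (Fin m → ℚ)} (hg : IsMLP g)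
    (f : Fin k → (Fin d → ℚ) → ℚ) (hf : ∀ i, AffOver g (f i)) :
    IsMLP (fun x i => _root_.relu (f i x)) := by
  choose w b h using hf
  have := IsMLP.step hg (Matrix.of w) b
  convert this using 3 with x i
  rw [h]; rfl

theorem PL.extend {d : ℕ} {f : (Fin d → ℚ) → ℚ} (hf : PL f) :
    ∀ (m : ℕ) (g : (Fin d → ℚ) → (Fin m → ℚ)), IsMLP g →
      (∀ i, AffOver g (fun x => x i)) →
      ∃ (m' : ℕ) (g' : (Fin d → ℚ) → (Fin m' → ℚ)), IsMLP g' ∧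
        (∀ h, AffOver g h → AffOver g' h) ∧ AffOver g' f := by
  induction hf with
  | coord i => intro m g hg hc; exact ⟨m, g, hg, fun _ h => h, hc i⟩
  | const c => intro m g hg hc; exact ⟨m, g, hg, fun _ h => h, 0, c, by simp⟩
  | add _ _ ih1 ih2 =>
    intro m g hg hc
    obtain ⟨m1, g1, hg1, h1, a1⟩ := ih1 m g hg hc
    obtain ⟨m2, g2, hg2, h2, a2⟩ := ih2 m1 g1 hg1 (fun i => h1 _ (hc i))
    refine ⟨m2, g2, hg2, fun h hh => h2 _ (h1 _ hh), ?_⟩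
    obtain ⟨w, b, e⟩ := h2 _ a1
    obtain ⟨w', b', e'⟩ := a2
    refine ⟨w + w', b + b', fun x => ?_⟩
    simp only [e, e', Pi.add_apply, add_mul, Finset.sum_add_distrib]
    ring
  | smul c _ ih =>
    intro m g hg hc
    obtain ⟨m1, g1, hg1, h1, w, b, e⟩ := ih m g hg hc
    refine ⟨m1, g1, hg1, h1, fun j => c * w j, c * b, fun x => ?_⟩
    simp only [e, mul_add, Finset.mul_sum, mul_assoc]
  | @relu f _ ih =>
    intro m g hg hc
    obtain ⟨m1, g1, hg1, h1, a⟩ := ih m g hg hc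
    have key := IsMLP.layer hg1
      (Fin.cons f (fun i x => g1 x i) : Fin (m1 + 1) → (Fin d → ℚ) → ℚ)
      (fun i => by
        refine Fin.cases ?_ (fun j => ?_) i
        · simpa using a
        · simpa using AffOver.coord g1 j)
    refine ⟨m1 + 1, _, key, fun h hh => ?_, ?_⟩
    · obtain ⟨w, b, e⟩ := h1 h hh
      refine ⟨Fin.cons 0 w, b, fun x => ?_⟩
      rw [Fin.sum_univ_succ, e]
      have : ∀ j, _root_.relu (g1 x j) = g1 x j := fun j => max_eq_left (hg1.nonneg x j)
      simp [this]
    · refine ⟨Fin.cons 1 0, 0, fun x => ?_⟩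
      rw [Fin.sum_univ_succ]
      simp

theorem PL.extend_family {d : ℕ} (k : ℕ) (f : Fin k → (Fin d → ℚ) → ℚ) (hf : ∀ i, PL (f i)) :
    ∃ (m' : ℕ) (g' : (Fin d → ℚ) → (Fin m' → ℚ)), IsMLP g' ∧
        (∀ i, AffOver g' (fun x => x i)) ∧ ∀ i, AffOver g' (f i) := by
  induction k with
  | zero =>
    refine ⟨d + d, _, IsMLP.base (Matrix.of (Fin.append
      (fun i j => if j = i then 1 else 0) (fun i j => if j = i then -1 else 0))) 0,
      fun i => ?_, fun i => i.elim0⟩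
    refine ⟨Fin.append (fun j => if j = i then 1 else 0) (fun j => if j = i then -1 else 0), 0,
      fun x => ?_⟩
    rw [Fin.sum_univ_add]
    simp only [Matrix.of_apply, Fin.append_left, Fin.append_right]
    simp [_root_.relu]
    rcases le_total (x i) 0 with h | h
    · rw [max_eq_right h, max_eq_left (by linarith)]; ring
    · rw [max_eq_left h, max_eq_right (by linarith)]; ring
  | succ k ih =>
    obtain ⟨m, g, hg, hc, ha⟩ := ih (fun i => f i.succ) (fun i => hf _)
    obtain ⟨m1, g1, hg1, h1, a⟩ := (hf 0).extend m g hg hc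
    exact ⟨m1, g1, hg1, fun i => h1 _ (hc i), fun i => Fin.cases a (fun j => h1 _ (ha j)) i⟩

theorem PL.isMLP {d k : ℕ} (f : Fin k → (Fin d → ℚ) → ℚ) (hf : ∀ i, PL (f i)) :
    IsMLP (fun x i => _root_.relu (f i x)) := by
  obtain ⟨m, g, hg, -, ha⟩ := PL.extend_family k f hf
  exact hg.layer f ha

def gA (x : Fin 9 → ℚ) : ℚ := x 2 - relu (x 2 - 1)
def gH (x : Fin 9 → ℚ) : ℚ := relu (relu (1 - 2 * x 5) - gA x - x 1)
def gD (x : Fin 9 → ℚ) : ℚ := relu (2 * x 7 - 1)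
def gC (x : Fin 9 → ℚ) : ℚ := x 1 - gD x
def gB (x : Fin 9 → ℚ) : ℚ := 1 - x 1 - gA x - gH x

def stepFn : Fin 9 → (Fin 9 → ℚ) → ℚ :=
  ![fun x => 1 - gH x,
    fun x => gB x + gC x,
    fun x => relu (x 2 - 1),
    fun x => relu (x 3 - gD x) + relu (2 * x 3 - 1 + x 8 - 2 * (1 - gD x)),
    fun x => x 4 + (relu ((1/4) * (1 - x 6) - (1 - gD x))
      + relu ((1/2) * (1 - x 6) - x 8 - (1 - gD x))),
    fun x => 1 - (relu (1 - x 5 - gA x - gD x) + relu ((1/2) * (1 - x 5) - (1 - gA x))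
      + relu (2 * (1 - x 5) - 2 * (1 - gD x))),
    fun x => 1 - (relu (1 - x 6 - gD x) + relu ((1/4) * (1 - x 6) - (1 - gD x))),
    fun x => relu (1 - x 5 - (1 - gB x)) + relu (2 * x 7 - 2 * (1 - gC x)),
    fun x => relu (1 - 2 * x 3 - (1 - gB x)) + relu (1 - relu (1 - 2 * x 8) - (1 - gC x))]

theorem pl_gA : PL gA := by
  unfold gA; repeat' first | apply PL.sub | apply PL.add | apply PL.smul | apply PL.coord | apply PL.const | apply PL.relu
theorem pl_gH : PL gH := by
  have := pl_gA
  unfold gH; repeat' first | assumption | apply PL.sub | apply PL.add | apply PL.smul | apply PL.coord | apply PL.const | apply PL.relu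
theorem pl_gD : PL gD := by
  unfold gD; repeat' first | assumption | apply PL.sub | apply PL.add | apply PL.smul | apply PL.coord | apply PL.const | apply PL.relu
theorem pl_gC : PL gC := by
  have := pl_gD
  unfold gC; repeat' first | assumption | apply PL.sub | apply PL.add | apply PL.smul | apply PL.coord | apply PL.const | apply PL.relu
theorem pl_gB : PL gB := by
  have := pl_gA
  have := pl_gH
  unfold gB; repeat' first | assumption | apply PL.sub | apply PL.add | apply PL.smul | apply PL.coord | apply PL.const | apply PL.relu

theorem pl_stepFn (i : Fin 9) : PL (stepFn i) := by
  have := pl_gA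
  have := pl_gB
  have := pl_gC
  have := pl_gD
  have := pl_gH
  fin_cases i <;> simp only [stepFn] <;>
  repeat' first | assumption | apply PL.sub | apply PL.add | apply PL.smul | apply PL.coord | apply PL.const | apply PL.relu

def stepMLP : MLP 9 9 := ⟨fun x i => relu (stepFn i x), PL.isMLP _ pl_stepFn⟩

def st (a m n v r p q s y : ℚ) : Fin 9 → ℚ := ![a, m, n, v, r, 1 - p, 1 - q, s, y]

theorem relu_pos' {x : ℚ} (h : 0 ≤ x) : relu x = x := max_eq_left h
theorem relu_neg' {x : ℚ} (h : x ≤ 0) : relu x = 0 := max_eq_right h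

theorem step_eq (a m n v r p q s y A B C D H : ℚ)
    (hA : gA (st a m n v r p q s y) = A) (hB : gB (st a m n v r p q s y) = B)
    (hC : gC (st a m n v r p q s y) = C) (hD : gD (st a m n v r p q s y) = D)
    (hH : gH (st a m n v r p q s y) = H)
    (a' m' n' v' r' p' q' s' y' : ℚ)
    (ha : 1 - H = a') (ha0 : 0 ≤ a')
    (hm : B + C = m') (hm0 : 0 ≤ m')
    (hn : relu (n - 1) = n')
    (hv : relu (v - D) + relu (2 * v - 1 + y - 2 * (1 - D)) = v')
    (hr : r + (relu ((1/4) * q - (1 - D)) + relu ((1/2) * q - y - (1 - D))) = r') (hr0 : 0 ≤ r')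
    (hp : relu (p - A - D) + relu ((1/2) * p - (1 - A)) + relu (2 * p - 2 * (1 - D)) = p')
    (hp0 : p' ≤ 1)
    (hq : relu (q - D) + relu ((1/4) * q - (1 - D)) = q') (hq0 : q' ≤ 1)
    (hs : relu (p - (1 - B)) + relu (2 * s - 2 * (1 - C)) = s')
    (hy : relu (1 - 2 * v - (1 - B)) + relu (1 - relu (1 - 2 * y) - (1 - C)) = y') :
    stepMLP.eval (st a m n v r p q s y) = st a' m' n' v' r' p' q' s' y' := by
  have r0 : ∀ x, 0 ≤ relu x := fun x => le_max_right _ _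
  funext i
  fin_cases i
  · change relu (1 - gH _) = a'
    rw [hH, ha, relu_pos' ha0]
  · change relu (gB _ + gC _) = m'
    rw [hB, hC, hm, relu_pos' hm0]
  · change relu (relu (n - 1)) = n'
    rw [relu_pos' (r0 _), hn]
  · change relu (relu (v - gD _) + relu (2 * v - 1 + y - 2 * (1 - gD _))) = v'
    rw [hD, relu_pos' (add_nonneg (r0 _) (r0 _)), hv]
  · change relu (r + (relu ((1/4) * (1 - (1 - q)) - (1 - gD _))
      + relu ((1/2) * (1 - (1 - q)) - y - (1 - gD _)))) = r'
    rw [hD, sub_sub_cancel, hr, relu_pos' hr0]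
  · change relu (1 - (relu (1 - (1 - p) - gA _ - gD _) + relu ((1/2) * (1 - (1 - p)) - (1 - gA _))
      + relu (2 * (1 - (1 - p)) - 2 * (1 - gD _)))) = 1 - p'
    rw [hA, hD, sub_sub_cancel, hp, relu_pos' (by linarith)]
  · change relu (1 - (relu (1 - (1 - q) - gD _) + relu ((1/4) * (1 - (1 - q)) - (1 - gD _)))) = 1 - q'
    rw [hD, sub_sub_cancel, hq, relu_pos' (by linarith)]
  · change relu (relu (1 - (1 - p) - (1 - gB _)) + relu (2 * s - 2 * (1 - gC _))) = s'
    rw [hB, hC, sub_sub_cancel, relu_pos' (add_nonneg (r0 _) (r0 _)), hs]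
  · change relu (relu (1 - 2 * v - (1 - gB _)) + relu (1 - relu (1 - 2 * y) - (1 - gC _))) = y'
    rw [hB, hC, relu_pos' (add_nonneg (r0 _) (r0 _)), hy]

theorem st_gates (a m n v r p q s y : ℚ) :
    gA (st a m n v r p q s y) = n - relu (n - 1) ∧
    gD (st a m n v r p q s y) = relu (2 * s - 1) ∧
    gH (st a m n v r p q s y) = relu (relu (1 - 2 * (1 - p)) - (n - relu (n - 1)) - m) ∧
    gC (st a m n v r p q s y) = m - relu (2 * s - 1) ∧
    gB (st a m n v r p q s y) = 1 - m - (n - relu (n - 1))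
      - relu (relu (1 - 2 * (1 - p)) - (n - relu (n - 1)) - m) :=
  ⟨rfl, rfl, rfl, rfl, rfl⟩

theorem stepA (n v r p q : ℚ) (hn : 0 ≤ n) (hv : 0 ≤ v) (hv1 : v ≤ 1) (hr : 0 ≤ r)
    (hp : 0 ≤ p) (hp1 : p ≤ 1) (hq : 0 ≤ q) (hq1 : q ≤ 1) :
    stepMLP.eval (st 1 0 (n + 1) v r p q 0 0) = st 1 0 n v r (p / 2) q 0 0 := by
  obtain ⟨eA, eD, eH, eC, eB⟩ := st_gates 1 0 (n + 1) v r p q 0 0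
  apply step_eq _ _ _ _ _ _ _ _ _ 1 0 0 0 0 <;>
  (try simp only [eA, eB, eC, eD, eH, relu]) <;> grind

theorem stepB (v r p q : ℚ) (hv : 0 ≤ v) (hv1 : v ≤ 1) (hr : 0 ≤ r)
    (hp : 0 ≤ p) (hp1 : p ≤ 1 / 2) (hq : 0 ≤ q) (hq1 : q ≤ 1) :
    stepMLP.eval (st 1 0 0 v r p q 0 0) = st 1 1 0 v r p q p (relu (1 - 2 * v)) := by
  obtain ⟨eA, eD, eH, eC, eB⟩ := st_gates 1 0 0 v r p q 0 0
  apply step_eq _ _ _ _ _ _ _ _ _ 0 1 0 0 0 <;>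
  (try simp only [eA, eB, eC, eD, eH, relu]) <;> grind

theorem stepC (v r p q s y : ℚ) (hv : 0 ≤ v) (hv1 : v ≤ 1) (hr : 0 ≤ r)
    (hp : 0 ≤ p) (hp1 : p ≤ 1 / 2) (hq : 0 ≤ q) (hq1 : q ≤ 1)
    (hs : 0 ≤ s) (hs1 : s ≤ 1 / 2) (hy : 0 ≤ y) (hy1 : y ≤ 1) :
    stepMLP.eval (st 1 1 0 v r p q s y) = st 1 1 0 v r p q (2 * s) (min 1 (2 * y)) := by
  obtain ⟨eA, eD, eH, eC, eB⟩ := st_gates 1 1 0 v r p q s y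
  apply step_eq _ _ _ _ _ _ _ _ _ 0 0 1 0 0 <;>
  (try simp only [eA, eB, eC, eD, eH, relu]) <;> grind

theorem stepD0 (w r p q : ℚ) (hv : 0 ≤ w) (hv1 : w ≤ 1) (hr : 0 ≤ r)
    (hp : 0 ≤ p) (hp1 : p ≤ 1 / 2) (hq : 0 ≤ q) (hq1 : q ≤ 1) :
    stepMLP.eval (st 1 1 0 (w / 2) r p q 1 1) = st 1 0 0 w (r + q / 4) (2 * p) (q / 4) 0 0 := by
  obtain ⟨eA, eD, eH, eC, eB⟩ := st_gates 1 1 0 (w / 2) r p q 1 1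
  apply step_eq _ _ _ _ _ _ _ _ _ 0 0 0 1 0 <;>
  (try simp only [eA, eB, eC, eD, eH, relu]) <;> grind

theorem stepD1 (w r p q : ℚ) (hv : 0 ≤ w) (hv1 : w ≤ 1) (hr : 0 ≤ r)
    (hp : 0 ≤ p) (hp1 : p ≤ 1 / 2) (hq : 0 ≤ q) (hq1 : q ≤ 1) :
    stepMLP.eval (st 1 1 0 ((1 + w) / 2) r p q 1 0) =
      st 1 0 0 w (r + 3 * q / 4) (2 * p) (q / 4) 0 0 := by
  obtain ⟨eA, eD, eH, eC, eB⟩ := st_gates 1 1 0 ((1 + w) / 2) r p q 1 0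
  apply step_eq _ _ _ _ _ _ _ _ _ 0 0 0 1 0 <;>
  (try simp only [eA, eB, eC, eD, eH, relu]) <;> grind

theorem stepH (a r q : ℚ) (hr : 0 ≤ r) (hq : 0 ≤ q) (hq1 : q ≤ 1) :
    stepMLP.eval (st a 0 0 0 r 1 q 0 0) = st 0 0 0 0 r 1 q 0 0 := by
  obtain ⟨eA, eD, eH, eC, eB⟩ := st_gates a 0 0 0 r 1 q 0 0
  apply step_eq _ _ _ _ _ _ _ _ _ 0 0 0 0 1 <;>
  (try simp only [eA, eB, eC, eD, eH, relu]) <;> grind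

def Reach (x y : Fin 9 → ℚ) : Prop := ∃ k, stepMLP.eval^[k] x = y

theorem Reach.trans {x y z : Fin 9 → ℚ} (h1 : Reach x y) (h2 : Reach y z) : Reach x z := by
  obtain ⟨k, rfl⟩ := h1
  obtain ⟨l, rfl⟩ := h2
  exact ⟨l + k, Function.iterate_add_apply _ _ _ _⟩

theorem Reach.one {x y : Fin 9 → ℚ} (h : stepMLP.eval x = y) : Reach x y := ⟨1, h⟩

theorem half_pow_bounds (n : ℕ) : (0 : ℚ) < (1 / 2) ^ n ∧ ((1 : ℚ) / 2) ^ n ≤ 1 :=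
  ⟨by positivity, pow_le_one₀ (by norm_num) (by norm_num)⟩

theorem rbe_bounds (x : List Bool) : 0 ≤ rbe x ∧ rbe x ≤ 1 - (1 / 2) ^ x.length := by
  induction x with
  | nil => simp [rbe]
  | cons b t ih =>
    have := half_pow_bounds t.length
    simp only [rbe, List.length_cons, pow_succ]
    generalize ((1 : ℚ) / 2) ^ t.length = z at *
    cases b <;> simp <;> constructor <;> linarith

theorem phaseA (n : ℕ) (v p : ℚ) (hv : 0 ≤ v) (hv1 : v ≤ 1) (hp : 0 ≤ p) (hp1 : p ≤ 1) :
    Reach (st 1 0 n v 0 p 1 0 0) (st 1 0 0 v 0 (p * (1 / 2) ^ n) 1 0 0) := by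
  induction n generalizing p with
  | zero => exact ⟨0, by simp⟩
  | succ n ih =>
    have h := stepA n v 0 p 1 (by positivity) hv hv1 le_rfl hp hp1 (by norm_num) le_rfl
    have h2 := ih (p / 2) (by linarith) (by linarith)
    push_cast
    refine (Reach.one h).trans ?_
    convert h2 using 2
    ring

theorem phaseC (j : ℕ) (v r p q y z : ℚ) (hv : 0 ≤ v) (hv1 : v ≤ 1) (hr : 0 ≤ r)
    (hp : 0 ≤ p) (hp1 : p ≤ 1 / 2) (hq : 0 ≤ q) (hq1 : q ≤ 1)
    (hy : y = 0 ∧ z = 0 ∨ (1 / 2) ^ j ≤ y ∧ y ≤ 1 ∧ z = 1) :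
    Reach (st 1 1 0 v r p q ((1 / 2) ^ j) y) (st 1 1 0 v r p q 1 z) := by
  induction j generalizing y with
  | zero =>
    refine ⟨0, ?_⟩
    have : y = z := by
      rcases hy with h | h
      · rw [h.1, h.2]
      · simp at h; linarith
    simp [this]
  | succ j ih =>
    have hb := half_pow_bounds j
    rw [pow_succ] at hy ⊢
    have hy0 : 0 ≤ y ∧ y ≤ 1 := by
      rcases hy with h | h
      · rw [h.1]; norm_num
      · constructor <;> linarith
    have h := stepC v r p q ((1 / 2) ^ j * (1 / 2)) y hv hv1 hr hp hp1 hq hq1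
      (by linarith) (by linarith) hy0.1 hy0.2
    refine (Reach.one h).trans ?_
    have e : (2 : ℚ) * ((1 / 2) ^ j * (1 / 2)) = (1 / 2) ^ j := by ring
    rw [e]
    apply ih
    rcases hy with h | h
    · left; rw [h.1, h.2]; norm_num
    · right
      refine ⟨le_min hb.2 (by linarith), min_le_left _ _, h.2.2⟩

theorem phaseMain (x : List Bool) (r q : ℚ) (hr : 0 ≤ r) (hq : 0 ≤ q) (hq1 : q ≤ 1) :
    ∃ q', 0 ≤ q' ∧ q' ≤ 1 ∧ 0 ≤ r + q * rqe x ∧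
      Reach (st 1 0 0 (rbe x) r ((1 / 2) ^ x.length) q 0 0)
        (st 1 0 0 0 (r + q * rqe x) 1 q' 0 0) := by
  induction x generalizing r q with
  | nil => exact ⟨q, hq, hq1, by simpa [rqe] using hr, 0, by simp [rqe, rbe]⟩
  | cons b t ih =>
    have hb := half_pow_bounds t.length
    have ht := rbe_bounds t
    have hbt := rbe_bounds (b :: t)
    have hb' := half_pow_bounds (b :: t).length
    have e : ((1 : ℚ) / 2) ^ (b :: t).length = (1 / 2) ^ t.length / 2 := by
      rw [List.length_cons, pow_succ]; ring
    have hB := stepB (rbe (b :: t)) r ((1 / 2) ^ (b :: t).length) q hbt.1 (by linarith) hr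
      hb'.1.le (by linarith) hq hq1
    have hC := phaseC (b :: t).length (rbe (b :: t)) r ((1 / 2) ^ (b :: t).length) q
      (relu (1 - 2 * rbe (b :: t))) (if b then 0 else 1) hbt.1 (by linarith) hr hb'.1.le
      (by linarith) hq hq1 (by
        rw [e]
        cases b
        · right
          simp only [rbe]
          rw [relu_pos' (by simp; linarith)]
          simp only [Bool.false_eq_true, if_false, and_true]
          constructor <;> linarith
        · left
          simp only [rbe]
          rw [relu_neg' (by simp; linarith)]
          simp)
    have hBC := (Reach.one hB).trans hC
    have e2 : 2 * ((1 : ℚ) / 2) ^ (b :: t).length = (1 / 2) ^ t.length := by rw [e]; ring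
    cases b
    · have hD := stepD0 (rbe t) r ((1 / 2) ^ (false :: t).length) q ht.1 (by linarith) hr hb'.1.le
        (by linarith) hq hq1
      rw [e2] at hD
      obtain ⟨q', h0, h1, h2, h3⟩ := ih (r + q / 4) (q / 4) (by linarith) (by linarith) (by linarith)
      have er : r + q * rqe (false :: t) = r + q / 4 + q / 4 * rqe t := by
        simp [rqe]; ring
      have ev : rbe (false :: t) = rbe t / 2 := by simp [rbe]
      refine ⟨q', h0, h1, by rw [er]; exact h2, ?_⟩
      rw [er]
      refine hBC.trans (Reach.trans (Reach.one ?_) h3)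
      rw [← hD, ev]; rfl
    · have hD := stepD1 (rbe t) r ((1 / 2) ^ (true :: t).length) q ht.1 (by linarith) hr hb'.1.le
        (by linarith) hq hq1
      rw [e2] at hD
      obtain ⟨q', h0, h1, h2, h3⟩ := ih (r + 3 * q / 4) (q / 4) (by linarith) (by linarith)
        (by linarith)
      have er : r + q * rqe (true :: t) = r + 3 * q / 4 + q / 4 * rqe t := by
        simp [rqe]; ring
      have ev : rbe (true :: t) = (1 + rbe t) / 2 := by simp [rbe]
      refine ⟨q', h0, h1, by rw [er]; exact h2, ?_⟩
      rw [er]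
      refine hBC.trans (Reach.trans (Reach.one ?_) h3)
      rw [← hD, ev]; rfl

/-- There is a recurrent ReLU MLP which, started from
`(1, 0, L, rbe(x), 0, …, 0)` for a binary string `x` of length `L`, eventually stabilizes
with first coordinate `0` and fifth coordinate `rqe(x)`. -/
theorem mlp_b2q_translation :
    ∃ (d : ℕ) (hd : 5 ≤ d) (F : MLP d d), ∀ x : List Bool,
      ∃ T : ℕ,
        (∀ t, T ≤ t →
          F.eval^[t] (initVec d [1, 0, (x.length : ℚ), rbe x]) =
            F.eval^[T] (initVec d [1, 0, (x.length : ℚ), rbe x])) ∧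
        F.eval^[T] (initVec d [1, 0, (x.length : ℚ), rbe x]) ⟨0, by omega⟩ = 0 ∧
        F.eval^[T] (initVec d [1, 0, (x.length : ℚ), rbe x]) ⟨4, by omega⟩ = rqe x := by
  refine ⟨9, by norm_num, stepMLP, fun x => ?_⟩
  have hx := rbe_bounds x
  have hb := half_pow_bounds x.length
  have hi : initVec 9 [1, 0, (x.length : ℚ), rbe x] = st 1 0 x.length (rbe x) 0 1 1 0 0 := by
    funext i
    fin_cases i <;> simp [initVec, st]
  have h1 := phaseA x.length (rbe x) 1 hx.1 (by linarith) (by norm_num) le_rfl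
  rw [one_mul] at h1
  obtain ⟨q, hq, hq1, hr, h2⟩ := phaseMain x 0 1 le_rfl (by norm_num) le_rfl
  rw [zero_add, one_mul] at hr h2
  obtain ⟨T, hT⟩ := (h1.trans h2).trans (Reach.one (stepH 1 (rqe x) q hr hq hq1))
  have hfix := stepH 0 (rqe x) q hr hq hq1
  rw [hi]
  refine ⟨T, fun t ht => ?_, ?_, ?_⟩
  · obtain ⟨k, rfl⟩ := Nat.exists_eq_add_of_le' ht
    rw [Function.iterate_add_apply, hT]
    exact Function.iterate_fixed hfix k
  · rw [hT]; rfl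
  · rw [hT]; rfl
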